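/- Atomic jump at downward discontinuities: under the piecewise-regularity assumption, if t is a point where φ = c/w has a downward jump (φ(t+) < φ(t−)) and t is a limit point of Ω(α_opt) from both sides, then t ∈ Ω(α_opt), α_opt has a jump discontinuity at t with α_opt(t+) − α_opt(t−) = (1/2)·ln(φ(t−)/φ(t+)) > 0, and S_opt satisfies S_opt(t+)/S_opt(t−) = √(φ(t+)/φ(t−)) < 1. Moreover, if t is a point where φ has an upward jump (φ(t+) > φ(t−)), then t ∉ Ω(α_opt). -/

import Mathlib

open MeasureTheory intervalIntegral Real Set Filter Topology

noncomputable def Kker (T δ ηb t r : ℝ) : ℝ :=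
  if r < t then (1 - Real.exp (-(ηb + δ) * T))⁻¹ else (Real.exp ((ηb + δ) * T) - 1)⁻¹

noncomputable def Sfun (T δ ηb : ℝ) (c α : ℝ → ℝ) (t : ℝ) : ℝ :=
  Real.exp (-(α t) - δ * t) * ∫ r in (0:ℝ)..T, Kker T δ ηb t r * c r * Real.exp (α r + δ * r)

noncomputable def Phi (T δ ηb : ℝ) (c w α : ℝ → ℝ) : ℝ :=
  ∫ t in (0:ℝ)..T, w t * Sfun T δ ηb c α t

def MemM (T ηb : ℝ) (α : ℝ → ℝ) : Prop :=
  Monotone α ∧ (∀ t, ContinuousWithinAt α (Set.Ici t) t) ∧ α 0 = 0 ∧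
    (∀ t, α (t + T) = α t + α T) ∧ α T = T * ηb

noncomputable def hfun (T δ ηb : ℝ) (c w α : ℝ → ℝ) (t : ℝ) : ℝ :=
  w t * Real.exp (-(α t) - δ * t) *
      (∫ r in (0:ℝ)..T, Kker T δ ηb t r * c r * Real.exp (α r + δ * r)) -
    c t * Real.exp (α t + δ * t) *
      (∫ r in (0:ℝ)..T, Kker T δ ηb r t * w r * Real.exp (-(α r) - δ * r))

noncomputable def psi (T δ ηb : ℝ) (c w α : ℝ → ℝ) (t : ℝ) : ℝ :=
  - ∫ s in (0:ℝ)..t, hfun T δ ηb c w α s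

def SuppM (α : ℝ → ℝ) : Set ℝ := {t | ∀ ε > 0, 0 < α (t + ε) - α (t - ε)}

def IsOpt (T δ ηb : ℝ) (c w α : ℝ → ℝ) : Prop :=
  MemM T ηb α ∧ ∀ β, MemM T ηb β → Phi T δ ηb c w α ≤ Phi T δ ηb c w β

theorem foc_abs (μ : Measure ℝ) [SFinite μ] (g f ξ : ℝ → ℝ) (K : ℝ → ℝ → ℝ) (k M : ℝ)
    (hg : Integrable g μ) (hf : Integrable f μ) (hg0 : ∀ x, 0 ≤ g x) (hf0 : ∀ x, 0 ≤ f x)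
    (hK : Measurable (fun z : ℝ × ℝ => K z.1 z.2)) (hK0 : ∀ t r, 0 ≤ K t r) (hKk : ∀ t r, K t r ≤ k)
    (hξ : Measurable ξ) (hM : ∀ x, |ξ x| ≤ M)
    (hopt : ∀ ε : ℝ, 0 < ε → ε ≤ 1 → ∫ t, ∫ r, g t * K t r * f r ∂μ ∂μ ≤
      ∫ t, ∫ r, g t * K t r * f r * Real.exp (ε * (ξ r - ξ t)) ∂μ ∂μ) :
    ∫ t, ξ t * (g t * (∫ r, K t r * f r ∂μ) - f t * ∫ r, K r t * g r ∂μ) ∂μ ≤ 0 := by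
  have hM0 : 0 ≤ M := (abs_nonneg _).trans (hM 0)
  set F : ℝ × ℝ → ℝ := fun z => g z.1 * K z.1 z.2 * f z.2 with hF
  have hF0 : ∀ z, 0 ≤ F z := fun z => mul_nonneg (mul_nonneg (hg0 _) (hK0 _ _)) (hf0 _)
  have hFi : Integrable F (μ.prod μ) := by
    have h1 : Integrable (fun z : ℝ × ℝ => K z.1 z.2 * (g z.1 * f z.2)) (μ.prod μ) := by
      refine Integrable.bdd_mul (c := k) (hg.mul_prod hf) hK.aestronglyMeasurable ?_
      refine Eventually.of_forall fun z => ?_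
      rw [Real.norm_eq_abs, abs_of_nonneg (hK0 _ _)]
      exact hKk _ _
    refine h1.congr (Eventually.of_forall fun z => ?_)
    simp only [hF]; ring
  have hξ1 : Measurable (fun z : ℝ × ℝ => ξ z.1) := hξ.comp measurable_fst
  have hξ2 : Measurable (fun z : ℝ × ℝ => ξ z.2) := hξ.comp measurable_snd
  have hI1 : Integrable (fun z => F z * ξ z.1) (μ.prod μ) :=
    hFi.mul_bdd (c := M) hξ1.aestronglyMeasurable (Eventually.of_forall fun z => hM _)
  have hI2 : Integrable (fun z => F z * ξ z.2) (μ.prod μ) :=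
    hFi.mul_bdd (c := M) hξ2.aestronglyMeasurable (Eventually.of_forall fun z => hM _)
  have hd : ∀ z : ℝ × ℝ, |ξ z.2 - ξ z.1| ≤ 2 * M := by
    intro z
    have := abs_sub (ξ z.2) (ξ z.1)
    linarith [hM z.1, hM z.2]
  have hIe : ∀ ε : ℝ, 0 < ε → Integrable (fun z => F z * Real.exp (ε * (ξ z.2 - ξ z.1))) (μ.prod μ) := by
    intro ε hε
    refine hFi.mul_bdd (c := Real.exp (ε * (2 * M))) ?_ (Eventually.of_forall fun z => ?_)
    · exact (Real.measurable_exp.comp ((hξ2.sub hξ1).const_mul ε)).aestronglyMeasurable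
    · rw [Real.norm_eq_abs, abs_of_pos (Real.exp_pos _)]
      apply Real.exp_le_exp.mpr
      have := (le_abs_self _).trans (hd z)
      nlinarith
  set X := (∫ z, F z * ξ z.2 ∂(μ.prod μ)) - ∫ z, F z * ξ z.1 ∂(μ.prod μ) with hX
  set C := ∫ z, F z ∂(μ.prod μ) with hC
  have hC0 : 0 ≤ C := integral_nonneg hF0
  have key : ∀ ε : ℝ, 0 < ε → ε ≤ 1 → ε * (2 * M) ≤ 1 → 0 ≤ X + ε * (4 * M ^ 2 * C) := by
    intro ε h0 h1 h2
    have h3 := hopt ε h0 h1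
    have e1 : ∫ t, ∫ r, g t * K t r * f r ∂μ ∂μ = C := (integral_prod F hFi).symm
    have e2 : ∫ t, ∫ r, g t * K t r * f r * Real.exp (ε * (ξ r - ξ t)) ∂μ ∂μ
        = ∫ z, F z * Real.exp (ε * (ξ z.2 - ξ z.1)) ∂(μ.prod μ) :=
      (integral_prod _ (hIe ε h0)).symm
    rw [e1, e2] at h3
    have hId : Integrable (fun z => ε * (F z * ξ z.2 - F z * ξ z.1)) (μ.prod μ) :=
      (hI2.sub hI1).const_mul ε
    have hIq : Integrable (fun z => (ε ^ 2 * (4 * M ^ 2)) * F z) (μ.prod μ) := hFi.const_mul _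
    have h4 : ∫ z, F z * Real.exp (ε * (ξ z.2 - ξ z.1)) ∂(μ.prod μ) ≤
        ∫ z, ((F z + ε * (F z * ξ z.2 - F z * ξ z.1)) + (ε ^ 2 * (4 * M ^ 2)) * F z) ∂(μ.prod μ) := by
      refine integral_mono (hIe ε h0) ((hFi.add hId).add hIq) fun z => ?_
      have hz := hd z
      have hx : |ε * (ξ z.2 - ξ z.1)| ≤ 1 := by
        rw [abs_mul, abs_of_pos h0]; nlinarith
      have hb := (abs_le.mp (Real.abs_exp_sub_one_sub_id_le hx)).2
      have hq : (ξ z.2 - ξ z.1) ^ 2 ≤ 4 * M ^ 2 := by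
        rw [← sq_abs]; nlinarith [abs_nonneg (ξ z.2 - ξ z.1)]
      have hb2 : Real.exp (ε * (ξ z.2 - ξ z.1)) ≤ 1 + ε * (ξ z.2 - ξ z.1) + ε ^ 2 * (4 * M ^ 2) := by
        nlinarith [sq_nonneg ε]
      have := mul_le_mul_of_nonneg_left hb2 (hF0 z)
      show F z * Real.exp (ε * (ξ z.2 - ξ z.1)) ≤ _
      linarith
    have e3 : ∫ z, ((F z + ε * (F z * ξ z.2 - F z * ξ z.1)) + (ε ^ 2 * (4 * M ^ 2)) * F z) ∂(μ.prod μ)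
        = C + ε * X + ε ^ 2 * (4 * M ^ 2) * C := by
      have hs : Integrable (fun z => F z + ε * (F z * ξ z.2 - F z * ξ z.1)) (μ.prod μ) := hFi.add hId
      rw [MeasureTheory.integral_add hs hIq, MeasureTheory.integral_add hFi hId,
        MeasureTheory.integral_const_mul, MeasureTheory.integral_const_mul,
        MeasureTheory.integral_sub hI2 hI1]
    rw [e3] at h4
    have h5 : 0 ≤ ε * (X + ε * (4 * M ^ 2 * C)) := by nlinarith
    exact nonneg_of_mul_nonneg_right h5 h0
  have hXn : 0 ≤ X := by
    have ht : Tendsto (fun ε : ℝ => X + ε * (4 * M ^ 2 * C)) (𝓝[>] 0) (𝓝 X) := by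
      have : Continuous (fun ε : ℝ => X + ε * (4 * M ^ 2 * C)) := by fun_prop
      have h := (this.tendsto 0).mono_left (nhdsWithin_le_nhds (s := Ioi 0))
      simpa using h
    refine ge_of_tendsto ht ?_
    have h1 : ∀ᶠ ε : ℝ in 𝓝[>] 0, ε < 1 := nhdsWithin_le_nhds (gt_mem_nhds one_pos)
    have h2 : ∀ᶠ ε : ℝ in 𝓝[>] 0, ε < 1 / (2 * M + 1) :=
      nhdsWithin_le_nhds (gt_mem_nhds (by positivity))
    filter_upwards [h1, h2, self_mem_nhdsWithin] with ε h1 h2 h3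
    have h3 : 0 < ε := h3
    refine key ε h3 h1.le ?_
    rw [lt_div_iff₀ (by positivity)] at h2
    nlinarith
  have e1 : ∫ z, F z * ξ z.2 ∂(μ.prod μ) = ∫ t, ξ t * (f t * ∫ r, K r t * g r ∂μ) ∂μ := by
    rw [integral_prod_symm _ hI2]
    congr 1; ext t
    rw [← MeasureTheory.integral_const_mul, ← MeasureTheory.integral_const_mul]
    congr 1; ext r; simp only [hF]; ring
  have e2 : ∫ z, F z * ξ z.1 ∂(μ.prod μ) = ∫ t, ξ t * (g t * ∫ r, K t r * f r ∂μ) ∂μ := by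
    rw [integral_prod _ hI1]
    congr 1; ext t
    rw [← MeasureTheory.integral_const_mul, ← MeasureTheory.integral_const_mul]
    congr 1; ext r; simp only [hF]; ring
  have i2 : Integrable (fun t => ξ t * (f t * ∫ r, K r t * g r ∂μ)) μ := by
    refine hI2.integral_prod_right.congr (Eventually.of_forall fun t => ?_)
    show ∫ r, F (r, t) * ξ t ∂μ = _
    beta_reduce
    rw [← MeasureTheory.integral_const_mul, ← MeasureTheory.integral_const_mul]
    congr 1; ext r; simp only [hF]; ring
  have i1 : Integrable (fun t => ξ t * (g t * ∫ r, K t r * f r ∂μ)) μ := by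
    refine hI1.integral_prod_left.congr (Eventually.of_forall fun t => ?_)
    show ∫ r, F (t, r) * ξ t ∂μ = _
    beta_reduce
    rw [← MeasureTheory.integral_const_mul, ← MeasureTheory.integral_const_mul]
    congr 1; ext r; simp only [hF]; ring
  simp only [mul_sub]
  rw [MeasureTheory.integral_sub i1 i2, ← e1, ← e2]
  linarith

/-- local argument, left side -/
theorem left_abs (T s κ : ℝ) (α G : ℝ → ℝ) (hT : 0 < T) (hα : Monotone α)
    (hI : ∀ a b u : ℝ, IntervalIntegrable (fun t => (u - α t) * G t) volume a b)
    (hA : ∀ a b, a < b → b < a + T → ∫ t in a..b, (α b - α t) * G t ≤ 0)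
    (hs : s ∈ SuppM α) (hκ : 0 < κ) (hG : ∀ᶠ u in 𝓝[<] s, κ < G u)
    (hB : ∃ M, ∀ᶠ u in 𝓝 s, |G u| ≤ M) : False := by
  obtain ⟨M, hB⟩ := hB
  obtain ⟨e1, he1, hB⟩ := Metric.eventually_nhds_iff.mp hB
  obtain ⟨l, hl, hG⟩ := (mem_nhdsLT_iff_exists_Ioo_subset).mp hG
  have hl : l < s := hl
  have hM0 : 0 ≤ M := (abs_nonneg _).trans (hB (y := s) (by simpa using he1))
  set ε := min (min (e1 / 2) ((s - l) / 2)) (T / 4) with hε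
  have hε0 : 0 < ε := by
    simp only [hε, lt_min_iff]; refine ⟨⟨?_, ?_⟩, ?_⟩ <;> linarith
  have h1 : ε ≤ e1 / 2 := (min_le_left _ _).trans (min_le_left _ _)
  have h2 : ε ≤ (s - l) / 2 := (min_le_left _ _).trans (min_le_right _ _)
  have h3 : ε ≤ T / 4 := min_le_right _ _
  set e := κ * ε / (2 * (κ + 2 * M)) with he
  have hden : 0 < 2 * (κ + 2 * M) := by linarith
  have he0 : 0 < e := by positivity
  have hee : e * (2 * (κ + 2 * M)) = κ * ε := div_mul_cancel₀ _ hden.ne'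
  have heε : e ≤ ε / 2 := by
    by_contra! h; nlinarith
  set m := α (s + e) - α (s - e) with hm
  have hm0 : 0 < m := hs e he0
  have hneg := hA (s - ε) (s + e) (by linarith) (by linarith)
  rw [← intervalIntegral.integral_add_adjacent_intervals (hI (s - ε) (s - e) _) (hI (s - e) (s + e) _)] at hneg
  have b1 : (ε - e) * (m * κ) ≤ ∫ t in (s - ε)..(s - e), (α (s + e) - α t) * G t := by
    have := intervalIntegral.integral_mono_on (μ := volume) (a := s - ε) (b := s - e) (f := fun _ => m * κ)
      (by linarith) intervalIntegrable_const (hI (s - ε) (s - e) (α (s + e))) (fun x hx => by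
        have hg : κ < G x := hG ⟨by linarith [hx.1], by linarith [hx.2]⟩
        have ha := hα hx.2
        have : m ≤ α (s + e) - α x := by linarith
        exact mul_le_mul this hg.le hκ.le (hm0.le.trans this))
    rw [intervalIntegral.integral_const, smul_eq_mul] at this
    convert this using 2; ring
  have b2 : (2 * e) * (-(m * M)) ≤ ∫ t in (s - e)..(s + e), (α (s + e) - α t) * G t := by
    have := intervalIntegral.integral_mono_on (μ := volume) (a := s - e) (b := s + e) (f := fun _ => -(m * M))
      (by linarith) intervalIntegrable_const (hI (s - e) (s + e) (α (s + e))) (fun x hx => by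
        have hg := abs_le.mp (hB (y := x) (by
          rw [Real.dist_eq, abs_lt]; constructor <;> linarith [hx.1, hx.2]))
        have ha := hα hx.2
        have ha' := hα hx.1
        have h5 : 0 ≤ α (s + e) - α x := by linarith
        have h6 : α (s + e) - α x ≤ m := by linarith
        nlinarith [mul_le_mul_of_nonneg_left hg.1 h5])
    rw [intervalIntegral.integral_const, smul_eq_mul] at this
    convert this using 2; ring
  have : 0 < m * (κ * ε - e * (κ + 2 * M)) := by
    apply mul_pos hm0; nlinarith [mul_pos hκ hε0]
  nlinarith

theorem right_abs (T s κ : ℝ) (α G : ℝ → ℝ) (hT : 0 < T) (hα : Monotone α)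
    (hI : ∀ a b u : ℝ, IntervalIntegrable (fun t => (u - α t) * G t) volume a b)
    (hA : ∀ a b, a < b → b < a + T → ∫ t in a..b, (α a - α t) * G t ≤ 0)
    (hs : s ∈ SuppM α) (hκ : 0 < κ) (hG : ∀ᶠ u in 𝓝[>] s, G u < -κ)
    (hB : ∃ M, ∀ᶠ u in 𝓝 s, |G u| ≤ M) : False := by
  refine left_abs T (-s) κ (fun t => - α (-t)) (fun t => - G (-t)) hT ?_ ?_ ?_ ?_ hκ ?_ ?_
  · intro a b h; exact neg_le_neg (hα (neg_le_neg h))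
  · intro a b u
    have h := (IntervalIntegrable.iff_comp_neg enorm_ne_top).mp (hI (-a) (-b) (-u))
    simp only [neg_neg] at h
    refine h.congr (fun x _ => ?_)
    ring
  · intro a b hab hb
    have h := hA (-b) (-a) (by linarith) (by linarith)
    rw [← intervalIntegral.integral_comp_neg (fun t => (α (-b) - α t) * G t)] at h
    convert h using 2
    ext x; ring
  · intro ε hε
    have := hs ε hε
    have e1 : -(-s + ε) = s - ε := by ring
    have e2 : -(-s - ε) = s + ε := by ring
    simp only [e1, e2]; linarith
  · have ht : Tendsto (fun u : ℝ => -u) (𝓝[<] (-s)) (𝓝[>] s) := by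
      simpa using tendsto_neg_nhdsLT (a := -s)
    filter_upwards [ht.eventually hG] with u hu
    linarith
  · obtain ⟨M, hB⟩ := hB
    refine ⟨M, ?_⟩
    have ht : Tendsto (fun u : ℝ => -u) (𝓝 (-s)) (𝓝 s) := by
      simpa using (continuous_neg.tendsto (-s))
    filter_upwards [ht.eventually hB] with u hu
    simpa using hu

theorem intg_mul (c u : ℝ → ℝ) (a b M : ℝ) (hc : IntervalIntegrable c volume a b) (hu : Measurable u)
    (hM : ∀ x ∈ Set.uIcc a b, |u x| ≤ M) : IntervalIntegrable (fun x => c x * u x) volume a b := by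
  rw [intervalIntegrable_iff] at *
  refine Integrable.mul_bdd (c := M) hc hu.aestronglyMeasurable ?_
  refine (ae_restrict_iff' measurableSet_uIoc).mpr (Eventually.of_forall fun x hx => ?_)
  exact hM x (uIoc_subset_uIcc hx)

noncomputable def fE (δ : ℝ) (c α : ℝ → ℝ) (r : ℝ) : ℝ := c r * Real.exp (α r + δ * r)
noncomputable def gE (δ : ℝ) (w α : ℝ → ℝ) (r : ℝ) : ℝ := w r * Real.exp (-(α r) - δ * r)
noncomputable def GG (T δ : ℝ) (c w α : ℝ → ℝ) (s : ℝ) : ℝ :=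
  gE δ w α s * (∫ r in (s - T)..s, fE δ c α r) - fE δ c α s * ∫ r in s..(s + T), gE δ w α r

theorem fE_int (T δ : ℝ) (c α : ℝ → ℝ) (hT : 0 < T) (hδ : 0 < δ) (hα : Monotone α)
    (hcP : ∀ s, c (s + T) = c s) (hcI : IntegrableOn c (Set.Icc 0 T)) (a b : ℝ) :
    IntervalIntegrable (fE δ c α) volume a b := by
  have h0 : IntervalIntegrable c volume 0 T :=
    (intervalIntegrable_iff_integrableOn_Icc_of_le hT.le).mpr hcI
  have h1 := Function.Periodic.intervalIntegrable₀ (f := c) hcP hT.ne' h0 a b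
  refine intg_mul c _ a b (Real.exp (α (max a b) + δ * (max a b))) h1 ?_ ?_
  · have := hα.measurable
    fun_prop
  · intro x hx
    rw [abs_of_pos (Real.exp_pos _), Real.exp_le_exp]
    have h2 : x ≤ max a b := hx.2
    have := hα h2
    nlinarith

theorem gE_int (T δ : ℝ) (c α : ℝ → ℝ) (hT : 0 < T) (hδ : 0 < δ) (hα : Monotone α)
    (hcP : ∀ s, c (s + T) = c s) (hcI : IntegrableOn c (Set.Icc 0 T)) (a b : ℝ) :
    IntervalIntegrable (gE δ c α) volume a b := by
  have h0 : IntervalIntegrable c volume 0 T :=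
    (intervalIntegrable_iff_integrableOn_Icc_of_le hT.le).mpr hcI
  have h1 := Function.Periodic.intervalIntegrable₀ (f := c) hcP hT.ne' h0 a b
  refine intg_mul c _ a b (Real.exp (-α (min a b) - δ * (min a b))) h1 ?_ ?_
  · have := hα.measurable
    fun_prop
  · intro x hx
    rw [abs_of_pos (Real.exp_pos _), Real.exp_le_exp]
    have h2 : min a b ≤ x := hx.1
    have := hα h2
    nlinarith

theorem fE_per (T δ ηb : ℝ) (c α : ℝ → ℝ) (hαP : ∀ t, α (t + T) = α t + T * ηb)
    (hcP : ∀ s, c (s + T) = c s) (s : ℝ) :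
    fE δ c α (s + T) = Real.exp ((ηb + δ) * T) * fE δ c α s := by
  unfold fE
  rw [hcP, hαP, mul_left_comm, ← Real.exp_add]
  ring_nf

theorem gE_per (T δ ηb : ℝ) (c α : ℝ → ℝ) (hαP : ∀ t, α (t + T) = α t + T * ηb)
    (hcP : ∀ s, c (s + T) = c s) (s : ℝ) :
    gE δ c α (s + T) = Real.exp (-(ηb + δ) * T) * gE δ c α s := by
  unfold gE
  rw [hcP, hαP, mul_left_comm, ← Real.exp_add]
  ring_nf

theorem fint_per (T δ ηb : ℝ) (c α : ℝ → ℝ) (hαP : ∀ t, α (t + T) = α t + T * ηb)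
    (hcP : ∀ s, c (s + T) = c s) (a b : ℝ) :
    ∫ r in (a + T)..(b + T), fE δ c α r = Real.exp ((ηb + δ) * T) * ∫ r in a..b, fE δ c α r := by
  rw [← intervalIntegral.integral_comp_add_right, ← intervalIntegral.integral_const_mul]
  congr 1; ext x; exact fE_per T δ ηb c α hαP hcP x

theorem gint_per (T δ ηb : ℝ) (c α : ℝ → ℝ) (hαP : ∀ t, α (t + T) = α t + T * ηb)
    (hcP : ∀ s, c (s + T) = c s) (a b : ℝ) :
    ∫ r in (a + T)..(b + T), gE δ c α r = Real.exp (-(ηb + δ) * T) * ∫ r in a..b, gE δ c α r := by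
  rw [← intervalIntegral.integral_comp_add_right, ← intervalIntegral.integral_const_mul]
  congr 1; ext x; exact gE_per T δ ηb c α hαP hcP x

theorem GG_per (T δ ηb : ℝ) (c w α : ℝ → ℝ) (hαP : ∀ t, α (t + T) = α t + T * ηb)
    (hcP : ∀ s, c (s + T) = c s) (hwP : ∀ s, w (s + T) = w s) :
    Function.Periodic (GG T δ c w α) T := by
  intro s
  have e : Real.exp ((ηb + δ) * T) * Real.exp (-(ηb + δ) * T) = 1 := by
    rw [← Real.exp_add, neg_mul, add_neg_cancel, Real.exp_zero]
  unfold GG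
  have h1 := fint_per T δ ηb c α hαP hcP (s - T) s
  rw [sub_add_cancel] at h1
  rw [add_sub_cancel_right, gint_per T δ ηb w α hαP hwP, fE_per T δ ηb c α hαP hcP,
    gE_per T δ ηb w α hαP hwP]
  rw [h1]
  linear_combination (gE δ w α s * (∫ r in (s - T)..s, fE δ c α r) - fE δ c α s * ∫ r in s..(s + T), gE δ w α r) * e

theorem GG_int (T δ : ℝ) (c w α : ℝ → ℝ)
    (hf : ∀ a b, IntervalIntegrable (fE δ c α) volume a b)
    (hg : ∀ a b, IntervalIntegrable (gE δ w α) volume a b) (a b : ℝ) :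
    IntervalIntegrable (GG T δ c w α) volume a b := by
  have hc1 : Continuous (fun s => ∫ r in (s - T)..s, fE δ c α r) := by
    have := intervalIntegral.continuous_primitive hf 0
    have h2 : (fun s => ∫ r in (s - T)..s, fE δ c α r) =
      fun s => (∫ r in (0:ℝ)..s, fE δ c α r) - ∫ r in (0:ℝ)..(s - T), fE δ c α r := by
      ext s; rw [intervalIntegral.integral_interval_sub_left (hf _ _) (hf _ _)]
    rw [h2]
    exact this.sub (this.comp (continuous_id.sub continuous_const))
  have hc2 : Continuous (fun s => ∫ r in s..(s + T), gE δ w α r) := by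
    have := intervalIntegral.continuous_primitive hg 0
    have h2 : (fun s => ∫ r in s..(s + T), gE δ w α r) =
      fun s => (∫ r in (0:ℝ)..(s + T), gE δ w α r) - ∫ r in (0:ℝ)..s, gE δ w α r := by
      ext s; rw [intervalIntegral.integral_interval_sub_left (hg _ _) (hg _ _)]
    rw [h2]
    exact (this.comp (continuous_id.add continuous_const)).sub this
  exact ((hg a b).mul_continuousOn hc1.continuousOn).sub ((hf a b).mul_continuousOn hc2.continuousOn)

theorem K_int (T k1 k2 t : ℝ) (f : ℝ → ℝ) (hT : 0 < T)
    (hf : ∀ a b, IntervalIntegrable f volume a b) :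
    ∫ r in (0:ℝ)..T, (if r < t then k1 else k2) * f r =
      k1 * (∫ r in (0:ℝ)..(max 0 (min t T)), f r) + k2 * ∫ r in (max 0 (min t T))..T, f r := by
  set τ := max 0 (min t T) with hτ
  have h0 : 0 ≤ τ := le_max_left _ _
  have h1 : τ ≤ T := max_le hT.le (min_le_right _ _)
  have hne : ∀ᵐ r : ℝ ∂volume, r ≠ τ := by
    rw [ae_iff]; simp
  have c1 : ∀ᵐ r : ℝ ∂volume, r ∈ Set.uIoc 0 τ → k1 * f r = (if r < t then k1 else k2) * f r := by
    filter_upwards [hne] with r hr h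
    rw [Set.uIoc_of_le h0] at h
    have h2 : r < τ := lt_of_le_of_ne h.2 hr
    have : r < t := by
      rcases lt_max_iff.mp h2 with h3 | h3
      · linarith [h.1]
      · exact (lt_min_iff.mp h3).1
    rw [if_pos this]
  have c2 : ∀ᵐ r : ℝ ∂volume, r ∈ Set.uIoc τ T → k2 * f r = (if r < t then k1 else k2) * f r := by
    filter_upwards with r h
    rw [Set.uIoc_of_le h1] at h
    have : ¬ r < t := by
      intro h3
      have := (le_max_right 0 (min t T)).trans_lt h.1
      rcases min_lt_iff.mp this with h4 | h4
      · linarith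
      · linarith [h.2]
    rw [if_neg this]
  rw [← intervalIntegral.integral_const_mul, ← intervalIntegral.integral_const_mul,
    intervalIntegral.integral_congr_ae c1, intervalIntegral.integral_congr_ae c2,
    intervalIntegral.integral_add_adjacent_intervals]
  · exact ((hf 0 τ).const_mul k1).congr_ae ((ae_restrict_iff' measurableSet_uIoc).mpr c1)
  · exact ((hf τ T).const_mul k2).congr_ae ((ae_restrict_iff' measurableSet_uIoc).mpr c2)

theorem K_int' (T k1 k2 t : ℝ) (f : ℝ → ℝ) (hT : 0 < T)
    (hf : ∀ a b, IntervalIntegrable f volume a b) :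
    ∫ r in (0:ℝ)..T, (if t < r then k1 else k2) * f r =
      k2 * (∫ r in (0:ℝ)..(max 0 (min t T)), f r) + k1 * ∫ r in (max 0 (min t T))..T, f r := by
  rw [← K_int T k2 k1 t f hT hf]
  apply intervalIntegral.integral_congr_ae
  have hne : ∀ᵐ r : ℝ ∂volume, r ≠ t := by
    rw [ae_iff]; simp
  filter_upwards [hne] with r hr _
  rcases lt_or_gt_of_ne hr with h | h
  · rw [if_pos h, if_neg h.not_gt]
  · rw [if_pos h, if_neg h.not_gt]

theorem k_rel (T lam : ℝ) (hT : 0 < T) (hlam : 0 < lam) :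
    0 < (1 - Real.exp (-lam * T))⁻¹ ∧ (Real.exp (lam * T) - 1)⁻¹ = (1 - Real.exp (-lam * T))⁻¹ * Real.exp (-lam * T) := by
  have h1 : Real.exp (-lam * T) < 1 := by
    rw [Real.exp_lt_one_iff]; nlinarith
  have h2 : 1 < Real.exp (lam * T) := by
    rw [Real.one_lt_exp_iff]; positivity
  refine ⟨inv_pos.mpr (by linarith), ?_⟩
  have e : Real.exp (lam * T) * Real.exp (-lam * T) = 1 := by
    rw [← Real.exp_add]; simp
  have h3 : (1 - Real.exp (-lam * T)) ≠ 0 := by linarith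
  have h5 : (Real.exp (lam * T) - 1) * Real.exp (-lam * T) = 1 - Real.exp (-lam * T) := by
    rw [sub_mul, e, one_mul]
  apply inv_eq_of_mul_eq_one_right
  rw [mul_left_comm, h5, inv_mul_cancel₀ h3]

theorem h_eq (T δ ηb : ℝ) (c w α : ℝ → ℝ) (hT : 0 < T) (hlam : 0 < ηb + δ)
    (hαP : ∀ t, α (t + T) = α t + T * ηb)
    (hcP : ∀ s, c (s + T) = c s) (hwP : ∀ s, w (s + T) = w s)
    (hf : ∀ a b, IntervalIntegrable (fE δ c α) volume a b)
    (hg : ∀ a b, IntervalIntegrable (gE δ w α) volume a b) (t : ℝ) (ht : t ∈ Set.Icc 0 T) :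
    gE δ w α t * (∫ r in (0:ℝ)..T, Kker T δ ηb t r * fE δ c α r) -
      fE δ c α t * (∫ r in (0:ℝ)..T, Kker T δ ηb r t * gE δ w α r) =
    (1 - Real.exp (-(ηb + δ) * T))⁻¹ * GG T δ c w α t := by
  have hm : max 0 (min t T) = t := by rw [min_eq_left ht.2, max_eq_right ht.1]
  unfold Kker
  rw [K_int _ _ _ _ _ hT hf, K_int' _ _ _ _ _ hT hg, hm, (k_rel T _ hT hlam).2]
  unfold GG
  have h1 := fint_per T δ ηb c α hαP hcP (t - T) 0
  rw [sub_add_cancel, zero_add] at h1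
  have h2 := gint_per T δ ηb w α hαP hwP 0 t
  rw [zero_add] at h2
  rw [h1, ← intervalIntegral.integral_add_adjacent_intervals (hf (t - T) 0) (hf 0 t),
    ← intervalIntegral.integral_add_adjacent_intervals (hg t T) (hg T (t + T)), h2]
  have e : Real.exp ((ηb + δ) * T) * Real.exp (-(ηb + δ) * T) = 1 := by
    rw [← Real.exp_add, neg_mul, add_neg_cancel, Real.exp_zero]
  linear_combination (1 - Real.exp (-(ηb + δ) * T))⁻¹ * gE δ w α t * (∫ r in (t - T)..0, fE δ c α r) * e

theorem K_meas (T δ ηb : ℝ) : Measurable (fun z : ℝ × ℝ => Kker T δ ηb z.1 z.2) := by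
  unfold Kker
  exact Measurable.ite (measurableSet_lt measurable_snd measurable_fst) measurable_const measurable_const

theorem K_pos (T δ ηb : ℝ) (hT : 0 < T) (hlam : 0 < ηb + δ) (t r : ℝ) : 0 < Kker T δ ηb t r := by
  obtain ⟨h1, h2⟩ := k_rel T (ηb + δ) hT hlam
  unfold Kker
  split_ifs
  · exact h1
  · rw [h2]; exact mul_pos h1 (Real.exp_pos _)

theorem K_le (T δ ηb : ℝ) (hT : 0 < T) (hlam : 0 < ηb + δ) (t r : ℝ) : Kker T δ ηb t r ≤
    (1 - Real.exp (-(ηb + δ) * T))⁻¹ + (Real.exp ((ηb + δ) * T) - 1)⁻¹ := by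
  obtain ⟨h1, h2⟩ := k_rel T (ηb + δ) hT hlam
  have h3 : 0 < (Real.exp ((ηb + δ) * T) - 1)⁻¹ := by
    rw [h2]; exact mul_pos h1 (Real.exp_pos _)
  unfold Kker
  split_ifs <;> linarith

theorem foc (T δ ηb : ℝ) (c w α β : ℝ → ℝ) (hT : 0 < T) (hδ : 0 < δ) (hη : 0 < ηb)
    (hc0 : ∀ s, 0 ≤ c s) (hcP : ∀ s, c (s + T) = c s) (hcI : IntegrableOn c (Set.Icc 0 T))
    (hw0 : ∀ s, 0 ≤ w s) (hwP : ∀ s, w (s + T) = w s) (hwI : IntegrableOn w (Set.Icc 0 T))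
    (hopt : IsOpt T δ ηb c w α)
    (hβ : Monotone β) (hβc : ∀ t, ContinuousWithinAt β (Set.Ici t) t)
    (hβP : ∀ t, β (t + T) = β t + T * ηb) :
    ∫ t in (0:ℝ)..T, (β t - α t) * GG T δ c w α t ≤ 0 := by
  obtain ⟨⟨hα, hαc, hα0, hαP', hαT⟩, hmin⟩ := hopt
  have hαP : ∀ t, α (t + T) = α t + T * ηb := fun t => by rw [hαP', hαT]
  have hlam : 0 < ηb + δ := by linarith
  have hf := fE_int T δ c α hT hδ hα hcP hcI
  have hg := gE_int T δ w α hT hδ hα hwP hwI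
  set μ : Measure ℝ := volume.restrict (Set.Ioc 0 T) with hμ
  have hfi : Integrable (fE δ c α) μ := (intervalIntegrable_iff_integrableOn_Ioc_of_le hT.le).mp (hf 0 T)
  have hgi : Integrable (gE δ w α) μ := (intervalIntegrable_iff_integrableOn_Ioc_of_le hT.le).mp (hg 0 T)
  set ξ : ℝ → ℝ := fun t => β t - α t with hξ
  have hξP : Function.Periodic ξ T := fun t => by simp only [hξ]; rw [hβP, hαP]; ring
  have hbd : ∀ x, |ξ x| ≤ |β 0| + |β T| + |α T| := by
    intro x
    obtain ⟨y, hy, hxy⟩ := hξP.exists_mem_Ico₀ hT x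
    rw [hxy]
    have b1 := hβ hy.1
    have b2 := hβ hy.2.le
    have a1 := hα hy.1
    have a2 := hα hy.2.le
    rw [hα0] at a1
    rw [abs_le]
    have := le_abs_self (β T); have := neg_abs_le (β 0); have := le_abs_self (α T)
    have := abs_nonneg (β T); have := abs_nonneg (β 0); have := abs_nonneg (α T)
    simp only [hξ]
    constructor <;> linarith
  have hPhi : ∀ (ε d : ℝ), Phi T δ ηb c w (fun t => α t + ε * (β t - d - α t)) =
      ∫ t, ∫ r, gE δ w α t * Kker T δ ηb t r * fE δ c α r * Real.exp (ε * (ξ r - ξ t)) ∂μ ∂μ := by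
    intro ε d
    unfold Phi Sfun
    rw [intervalIntegral.integral_of_le hT.le]
    congr 1; ext t
    rw [intervalIntegral.integral_of_le hT.le, ← MeasureTheory.integral_const_mul,
      ← MeasureTheory.integral_const_mul]
    congr 1; ext r
    have e1 : Real.exp (-(α t + ε * (β t - d - α t)) - δ * t) * Real.exp (α r + ε * (β r - d - α r) + δ * r)
      = Real.exp (-(α t) - δ * t) * Real.exp (α r + δ * r) * Real.exp (ε * (ξ r - ξ t)) := by
      rw [← Real.exp_add, ← Real.exp_add, ← Real.exp_add]
      congr 1; simp only [hξ]; ring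
    unfold gE fE
    linear_combination (w t * Kker T δ ηb t r * c r) * e1
  have key := foc_abs μ (gE δ w α) (fE δ c α) ξ (Kker T δ ηb) _ _ hgi hfi
    (fun x => mul_nonneg (hw0 x) (Real.exp_pos _).le) (fun x => mul_nonneg (hc0 x) (Real.exp_pos _).le)
    (K_meas T δ ηb) (fun t r => (K_pos T δ ηb hT hlam t r).le) (K_le T δ ηb hT hlam)
    (hβ.measurable.sub hα.measurable) hbd ?_
  · have e : ∫ t, ξ t * (gE δ w α t * (∫ r, Kker T δ ηb t r * fE δ c α r ∂μ) -
        fE δ c α t * ∫ r, Kker T δ ηb r t * gE δ w α r ∂μ) ∂μ =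
        (1 - Real.exp (-(ηb + δ) * T))⁻¹ * ∫ t in (0:ℝ)..T, (β t - α t) * GG T δ c w α t := by
      rw [← intervalIntegral.integral_const_mul, intervalIntegral.integral_of_le hT.le]
      refine setIntegral_congr_fun measurableSet_Ioc fun t ht => ?_
      have h := h_eq T δ ηb c w α hT hlam hαP hcP hwP hf hg t ⟨ht.1.le, ht.2⟩
      rw [intervalIntegral.integral_of_le hT.le, intervalIntegral.integral_of_le hT.le] at h
      beta_reduce
      rw [h]; simp only [hξ]; ring
    rw [e] at key
    exact nonpos_of_mul_nonpos_right key (k_rel T _ hT hlam).1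
  · intro ε h0 h1
    have hm := hmin (fun t => α t + ε * (β t - β 0 - α t)) ?_
    · rw [hPhi] at hm
      have h3 := hPhi 0 0
      simp only [zero_mul, add_zero, Real.exp_zero, mul_one] at h3
      rw [← h3]; exact hm
    · have hβT : β T = β 0 + T * ηb := by have := hβP 0; rwa [zero_add] at this
      refine ⟨?_, ?_, ?_, ?_, ?_⟩
      · intro a b hab
        have b1 := hα hab
        have b2 := hβ hab
        show α a + ε * (β a - β 0 - α a) ≤ α b + ε * (β b - β 0 - α b)
        nlinarith
      · intro t
        exact (hαc t).add ((((hβc t).sub continuousWithinAt_const).sub (hαc t)).const_smul ε)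
      · simp [hα0]
      · intro t
        beta_reduce
        rw [hαP, hβP, hαT, hβT]; ring
      · beta_reduce
        rw [hαT, hβT]; ring

theorem J_props (T v x q : ℝ) (hT : 0 < T) (hq : 0 ≤ q) :
    Monotone (fun t : ℝ => v + q * (⌊(t - x) / T⌋ : ℝ)) ∧
    (∀ t, ContinuousWithinAt (fun t : ℝ => v + q * (⌊(t - x) / T⌋ : ℝ)) (Set.Ici t) t) ∧
    (∀ t, (fun t : ℝ => v + q * (⌊(t - x) / T⌋ : ℝ)) (t + T) =
      (fun t : ℝ => v + q * (⌊(t - x) / T⌋ : ℝ)) t + q) ∧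
    (∀ t ∈ Set.Ico x (x + T), (fun t : ℝ => v + q * (⌊(t - x) / T⌋ : ℝ)) t = v) := by
  refine ⟨?_, ?_, ?_, ?_⟩
  · intro a b hab
    have h : (⌊(a - x) / T⌋ : ℝ) ≤ ⌊(b - x) / T⌋ := by
      exact_mod_cast Int.floor_le_floor (by gcongr)
    have := mul_le_mul_of_nonneg_left h hq
    show v + _ ≤ v + _
    linarith
  · intro t
    have h1 : Tendsto (fun s : ℝ => (s - x) / T) (𝓝[≥] t) (𝓝[≥] ((t - x) / T)) := by
      refine tendsto_nhdsWithin_iff.mpr ⟨?_, ?_⟩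
      · have : Continuous (fun s : ℝ => (s - x) / T) := by fun_prop
        exact (this.tendsto t).mono_left nhdsWithin_le_nhds
      · filter_upwards [self_mem_nhdsWithin] with s hs
        have hs : t ≤ s := hs
        show (t - x) / T ≤ (s - x) / T
        gcongr
    have h2 := (tendsto_floor_right_pure_floor ((t - x) / T)).comp h1
    have h3 : ∀ᶠ s in 𝓝[≥] t, ⌊(s - x) / T⌋ = ⌊(t - x) / T⌋ := by
      simpa using h2
    refine (tendsto_const_nhds (x := v + q * (⌊(t - x) / T⌋ : ℝ))).congr' ?_
    filter_upwards [h3] with s hs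
    rw [hs]
  · intro t
    have : (t + T - x) / T = (t - x) / T + 1 := by field_simp; ring
    beta_reduce
    rw [this, Int.floor_add_one]; push_cast; ring
  · intro t ht
    have : ⌊(t - x) / T⌋ = 0 := by
      rw [Int.floor_eq_zero_iff]
      refine ⟨div_nonneg (by linarith [ht.1]) hT.le, ?_⟩
      rw [div_lt_one hT]; linarith [ht.2]
    beta_reduce
    rw [this]; simp

theorem partA (T δ ηb : ℝ) (c w α : ℝ → ℝ) (hT : 0 < T) (hδ : 0 < δ) (hη : 0 < ηb)
    (hc0 : ∀ s, 0 ≤ c s) (hcP : ∀ s, c (s + T) = c s) (hcI : IntegrableOn c (Set.Icc 0 T))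
    (hw0 : ∀ s, 0 ≤ w s) (hwP : ∀ s, w (s + T) = w s) (hwI : IntegrableOn w (Set.Icc 0 T))
    (hopt : IsOpt T δ ηb c w α)
    (hI : ∀ a b u : ℝ, IntervalIntegrable (fun t => (u - α t) * GG T δ c w α t) volume a b)
    (a b : ℝ) (hab : a < b) (hb : b < a + T) :
    ∫ t in a..b, (α b - α t) * GG T δ c w α t ≤ 0 ∧
    ∫ t in a..b, (α a - α t) * GG T δ c w α t ≤ 0 := by
  have hα : Monotone α := hopt.1.1
  have hαc := hopt.1.2.1
  have hαP : ∀ t, α (t + T) = α t + T * ηb := fun t => by rw [hopt.1.2.2.2.1, hopt.1.2.2.2.2]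
  have hGP := GG_per T δ ηb c w α hαP hcP hwP
  have hne : ∀ y : ℝ, ∀ᵐ r : ℝ ∂volume, r ≠ y := by
    intro y; rw [ae_iff]; simp
  have gen : ∀ β : ℝ → ℝ, Monotone β → (∀ t, ContinuousWithinAt β (Set.Ici t) t) →
      (∀ t, β (t + T) = β t + T * ηb) → ∀ x, ∫ t in x..(x + T), (β t - α t) * GG T δ c w α t ≤ 0 := by
    intro β h1 h2 h3 x
    have h := foc T δ ηb c w α β hT hδ hη hc0 hcP hcI hw0 hwP hwI hopt h1 h2 h3
    have hp : Function.Periodic (fun t => (β t - α t) * GG T δ c w α t) T := by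
      intro t; beta_reduce; rw [h3, hαP, hGP t]; ring
    rw [hp.intervalIntegral_add_eq x 0, zero_add]
    exact h
  constructor
  · obtain ⟨j1, j2, j3, j4⟩ := J_props T (α b) a (T * ηb) hT (by positivity)
    set J : ℝ → ℝ := fun t : ℝ => α b + T * ηb * (⌊(t - a) / T⌋ : ℝ)
    have h := gen (fun t => max (α t) (J t)) (hα.max j1) (fun t => (hαc t).max (j2 t))
      (fun t => by beta_reduce; rw [hαP, j3, max_add_add_right]) a
    have z1 : ∀ᵐ t : ℝ ∂volume, t ∈ Set.uIoc a b →
        (α b - α t) * GG T δ c w α t = (max (α t) (J t) - α t) * GG T δ c w α t := by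
      filter_upwards with t ht
      rw [Set.uIoc_of_le hab.le] at ht
      rw [j4 t ⟨ht.1.le, by linarith [ht.2]⟩, max_eq_right (hα ht.2)]
    have z2 : ∀ᵐ t : ℝ ∂volume, t ∈ Set.uIoc b (a + T) →
        0 = (max (α t) (J t) - α t) * GG T δ c w α t := by
      filter_upwards [hne (a + T)] with t hn ht
      rw [Set.uIoc_of_le hb.le] at ht
      rw [j4 t ⟨by linarith [ht.1], lt_of_le_of_ne ht.2 hn⟩, max_eq_left (hα ht.1.le)]; ring
    rw [← intervalIntegral.integral_add_adjacent_intervals (b := b)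
      ((hI a b (α b)).congr_ae ((ae_restrict_iff' measurableSet_uIoc).mpr z1))
      ((intervalIntegrable_const (c := (0:ℝ))).congr_ae ((ae_restrict_iff' measurableSet_uIoc).mpr z2)),
      ← intervalIntegral.integral_congr_ae z1, ← intervalIntegral.integral_congr_ae z2] at h
    simpa using h
  · obtain ⟨j1, j2, j3, j4⟩ := J_props T (α a) (b - T) (T * ηb) hT (by positivity)
    set J : ℝ → ℝ := fun t : ℝ => α a + T * ηb * (⌊(t - (b - T)) / T⌋ : ℝ)
    have h := gen (fun t => min (α t) (J t)) (hα.min j1) (fun t => (hαc t).min (j2 t))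
      (fun t => by beta_reduce; rw [hαP, j3, min_add_add_right]) (b - T)
    rw [sub_add_cancel] at h j4
    have z1 : ∀ᵐ t : ℝ ∂volume, t ∈ Set.uIoc a b →
        (α a - α t) * GG T δ c w α t = (min (α t) (J t) - α t) * GG T δ c w α t := by
      filter_upwards [hne b] with t hn ht
      rw [Set.uIoc_of_le hab.le] at ht
      rw [j4 t ⟨by linarith [ht.1], lt_of_le_of_ne ht.2 hn⟩, min_eq_right (hα ht.1.le)]
    have z2 : ∀ᵐ t : ℝ ∂volume, t ∈ Set.uIoc (b - T) a →
        0 = (min (α t) (J t) - α t) * GG T δ c w α t := by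
      filter_upwards with t ht
      rw [Set.uIoc_of_le (by linarith)] at ht
      rw [j4 t ⟨ht.1.le, by linarith [ht.2]⟩, min_eq_left (hα ht.2)]; ring
    rw [← intervalIntegral.integral_add_adjacent_intervals (b := a)
      ((intervalIntegrable_const (c := (0:ℝ))).congr_ae ((ae_restrict_iff' measurableSet_uIoc).mpr z2))
      ((hI a b (α a)).congr_ae ((ae_restrict_iff' measurableSet_uIoc).mpr z1)),
      ← intervalIntegral.integral_congr_ae z1, ← intervalIntegral.integral_congr_ae z2] at h
    simpa using h

theorem prim_cont (f : ℝ → ℝ) (hf : ∀ a b, IntervalIntegrable f volume a b) (u v : ℝ → ℝ)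
    (hu : Continuous u) (hv : Continuous v) : Continuous (fun s => ∫ r in (u s)..(v s), f r) := by
  have := intervalIntegral.continuous_primitive hf 0
  have h2 : (fun s => ∫ r in (u s)..(v s), f r) =
      fun s => (∫ r in (0:ℝ)..(v s), f r) - ∫ r in (0:ℝ)..(u s), f r := by
    ext s; rw [intervalIntegral.integral_interval_sub_left (hf _ _) (hf _ _)]
  rw [h2]
  exact (this.comp hv).sub (this.comp hu)

theorem int_pos (f : ℝ → ℝ) (hf : ∀ a b, IntervalIntegrable f volume a b) (h0 : ∀ x, 0 ≤ f x)
    (hp : ∀ s, ∀ᶠ u in 𝓝[>] s, 0 < f u) (a b : ℝ) (hab : a < b) : 0 < ∫ r in a..b, f r := by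
  obtain ⟨l, hl, hs⟩ := (mem_nhdsGT_iff_exists_Ioo_subset).mp (hp a)
  have hl : a < l := hl
  have h1 : 0 < ∫ r in a..(min l b), f r := by
    refine intervalIntegral.intervalIntegral_pos_of_pos_on (hf _ _) (fun x hx => ?_) (lt_min hl hab)
    exact hs ⟨hx.1, hx.2.trans_le (min_le_left _ _)⟩
  refine h1.trans_le ?_
  exact intervalIntegral.integral_mono_interval le_rfl (lt_min hl hab).le (min_le_right _ _)
    (Eventually.of_forall h0) (hf _ _)

theorem locb (G : ℝ → ℝ) (s gp gm : ℝ) (hp : Tendsto G (𝓝[>] s) (𝓝 gp))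
    (hm : Tendsto G (𝓝[<] s) (𝓝 gm)) : ∃ M, ∀ᶠ u in 𝓝 s, |G u| ≤ M := by
  have h1 : ∀ᶠ u in 𝓝[>] s, |G u| < |gp| + 1 := hp.abs.eventually (gt_mem_nhds (by linarith))
  have h2 : ∀ᶠ u in 𝓝[<] s, |G u| < |gm| + 1 := hm.abs.eventually (gt_mem_nhds (by linarith))
  rw [eventually_nhdsWithin_iff] at h1 h2
  refine ⟨|gp| + |gm| + |G s| + 1, ?_⟩
  filter_upwards [h1, h2] with u h1 h2
  have := abs_nonneg gp; have := abs_nonneg gm; have := abs_nonneg (G s)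
  rcases lt_trichotomy u s with h | h | h
  · linarith [h2 h]
  · rw [h]; linarith
  · linarith [h1 h]

theorem partC (T : ℝ) (α G : ℝ → ℝ) (hT : 0 < T) (hα : Monotone α)
    (hI : ∀ a b u : ℝ, IntervalIntegrable (fun t => (u - α t) * G t) volume a b)
    (hA : ∀ a b, a < b → b < a + T → ∫ t in a..b, (α b - α t) * G t ≤ 0 ∧
      ∫ t in a..b, (α a - α t) * G t ≤ 0)
    (hL : ∀ s, ∃ gp gm, Tendsto G (𝓝[>] s) (𝓝 gp) ∧ Tendsto G (𝓝[<] s) (𝓝 gm))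
    (t gp gm : ℝ) (hp : Tendsto G (𝓝[>] t) (𝓝 gp)) (hm : Tendsto G (𝓝[<] t) (𝓝 gm)) :
    (t ∈ SuppM α → 0 ≤ gp ∧ gm ≤ 0) ∧ (t ∈ closure (SuppM α ∩ Set.Ioi t) → gp ≤ 0) ∧
    (t ∈ closure (SuppM α ∩ Set.Iio t) → 0 ≤ gm) := by
  have hB : ∀ s, ∃ M, ∀ᶠ u in 𝓝 s, |G u| ≤ M := fun s => by
    obtain ⟨a, b, h1, h2⟩ := hL s
    exact locb G s a b h1 h2
  have L : ∀ s ∈ SuppM α, ∀ κ > 0, ¬ ∀ᶠ u in 𝓝[<] s, κ < G u := fun s hs κ hκ h =>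
    left_abs T s κ α G hT hα hI (fun a b h1 h2 => (hA a b h1 h2).1) hs hκ h (hB s)
  have R : ∀ s ∈ SuppM α, ∀ κ > 0, ¬ ∀ᶠ u in 𝓝[>] s, G u < -κ := fun s hs κ hκ h =>
    right_abs T s κ α G hT hα hI (fun a b h1 h2 => (hA a b h1 h2).2) hs hκ h (hB s)
  refine ⟨fun ht => ⟨?_, ?_⟩, fun ht => ?_, fun ht => ?_⟩
  · by_contra! h
    exact R t ht (-gp / 2) (by linarith) (hp.eventually (gt_mem_nhds (by linarith)))
  · by_contra! h
    exact L t ht (gm / 2) (by linarith) (hm.eventually (lt_mem_nhds (by linarith)))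
  · by_contra! h
    have h1 : ∀ᶠ u in 𝓝[>] t, gp / 2 < G u := hp.eventually (lt_mem_nhds (by linarith))
    obtain ⟨l, hl, hs⟩ := (mem_nhdsGT_iff_exists_Ioo_subset).mp h1
    have hl : t < l := hl
    obtain ⟨s, hs1, hs2, hs3⟩ := mem_closure_iff_nhds.mp ht _ (Iio_mem_nhds hl)
    have hs1 : s < l := hs1
    have hs3 : t < s := hs3
    refine L s hs2 (gp / 2) (by linarith) ?_
    filter_upwards [Ioo_mem_nhdsLT hs3] with u hu
    exact hs ⟨hu.1, hu.2.trans hs1⟩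
  · by_contra! h
    have h1 : ∀ᶠ u in 𝓝[<] t, G u < -(-gm / 2) := hm.eventually (gt_mem_nhds (by linarith))
    obtain ⟨l, hl, hs⟩ := (mem_nhdsLT_iff_exists_Ioo_subset).mp h1
    have hl : l < t := hl
    obtain ⟨s, hs1, hs2, hs3⟩ := mem_closure_iff_nhds.mp ht _ (Ioi_mem_nhds hl)
    have hs1 : l < s := hs1
    have hs3 : s < t := hs3
    refine R s hs2 (-gm / 2) (by linarith) ?_
    filter_upwards [Ioo_mem_nhdsGT hs3] with u hu
    exact hs ⟨hs1.trans hu.1, hu.2⟩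

theorem supp_closed (α : ℝ → ℝ) (hα : Monotone α) (A : Set ℝ) (t : ℝ)
    (ht : t ∈ closure (SuppM α ∩ A)) : t ∈ SuppM α := by
  intro ε hε
  obtain ⟨s, hs, hd⟩ := Metric.mem_closure_iff.mp ht (ε / 2) (by linarith)
  rw [Real.dist_eq, abs_lt] at hd
  have h1 := hs.1 (ε / 2) (by linarith)
  have h2 : α (s + ε / 2) ≤ α (t + ε) := hα (by linarith)
  have h3 : α (t - ε) ≤ α (s - ε / 2) := hα (by linarith)
  linarith

theorem stmt18 (T δ ηb : ℝ) (c w αopt : ℝ → ℝ) (t φp φm : ℝ)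
    (hT : 0 < T) (hδ : 0 < δ) (hη : 0 < ηb)
    (hc0 : ∀ s, 0 ≤ c s) (hcP : ∀ s, c (s + T) = c s) (hcI : IntegrableOn c (Set.Icc 0 T))
    (hw0 : ∀ s, 0 ≤ w s) (hwP : ∀ s, w (s + T) = w s) (hwI : IntegrableOn w (Set.Icc 0 T))
(hlim : ∀ t : ℝ, ∃ cp cm wp wm : ℝ,
      Tendsto c (nhdsWithin t (Set.Ioi t)) (𝓝 cp) ∧
      Tendsto c (nhdsWithin t (Set.Iio t)) (𝓝 cm) ∧
      Tendsto w (nhdsWithin t (Set.Ioi t)) (𝓝 wp) ∧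
      Tendsto w (nhdsWithin t (Set.Iio t)) (𝓝 wm) ∧
      0 < cp ∧ 0 < cm ∧ 0 < wp ∧ 0 < wm)
    (hDfin : ({t : ℝ | ¬ ContinuousAt (fun s => c s / w s) t} ∩ Set.Ico 0 T).Finite)
    (hdiff : ∃ E : Set ℝ, E.Countable ∧
      ∀ t ∈ {t : ℝ | ContinuousAt (fun s => c s / w s) t} \ E,
        DifferentiableAt ℝ c t ∧ DifferentiableAt ℝ w t)
    (hAC : ∀ a b : ℝ, a ≤ b →
      Set.Icc a b ⊆ {t : ℝ | ContinuousAt (fun s => c s / w s) t} →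
      (∀ x ∈ Set.Icc a b, c x = c a + ∫ s in a..x, deriv c s) ∧
      (∀ x ∈ Set.Icc a b, w x = w a + ∫ s in a..x, deriv w s))
    (hopt : IsOpt T δ ηb c w αopt)
    (hφp : Tendsto (fun s => c s / w s) (nhdsWithin t (Set.Ioi t)) (𝓝 φp))
    (hφm : Tendsto (fun s => c s / w s) (nhdsWithin t (Set.Iio t)) (𝓝 φm)) :
    (φm < φp → t ∉ SuppM αopt) ∧
    (φp < φm →
      t ∈ closure (SuppM αopt ∩ Set.Ioi t) →
      t ∈ closure (SuppM αopt ∩ Set.Iio t) →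
      t ∈ SuppM αopt ∧
      (∀ ap am : ℝ,
        Tendsto αopt (nhdsWithin t (Set.Ioi t)) (𝓝 ap) →
        Tendsto αopt (nhdsWithin t (Set.Iio t)) (𝓝 am) →
        ap - am = (1/2) * Real.log (φm / φp) ∧ 0 < ap - am) ∧
      (∀ Sp Sm : ℝ,
        Tendsto (Sfun T δ ηb c αopt) (nhdsWithin t (Set.Ioi t)) (𝓝 Sp) →
        Tendsto (Sfun T δ ηb c αopt) (nhdsWithin t (Set.Iio t)) (𝓝 Sm) →
        Sp / Sm = Real.sqrt (φp / φm) ∧ Sp / Sm < 1)) := by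
  obtain ⟨cp, cm, wp, wm, hcp, hcm, hwp, hwm, pcp, pcm, pwp, pwm⟩ := hlim t
  have hα : Monotone αopt := hopt.1.1
  have hlam : 0 < ηb + δ := by linarith
  have hf := fE_int T δ c αopt hT hδ hα hcP hcI
  have hg := gE_int T δ w αopt hT hδ hα hwP hwI
  have hGi := GG_int T δ c w αopt hf hg
  have hI : ∀ a b u : ℝ, IntervalIntegrable (fun t => (u - αopt t) * GG T δ c w αopt t) volume a b := by
    intro a b u
    have h := intg_mul (GG T δ c w αopt) (fun t => u - αopt t) a b
      (|u| + |αopt (min a b)| + |αopt (max a b)|) (hGi a b) (measurable_const.sub hα.measurable) ?_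
    · simpa only [mul_comm] using h
    · intro x hx
      have h1 := hα hx.1
      have h2 := hα hx.2
      have := le_abs_self (αopt (max a b)); have := neg_abs_le (αopt (min a b))
      have := abs_nonneg (αopt (max a b)); have := abs_nonneg (αopt (min a b))
      have := le_abs_self u; have := neg_abs_le u
      rw [abs_le]
      constructor <;> linarith
  have hA := partA T δ ηb c w αopt hT hδ hη hc0 hcP hcI hw0 hwP hwI hopt hI
  have hf0 : ∀ x, 0 ≤ fE δ c αopt x := fun x => mul_nonneg (hc0 x) (Real.exp_pos _).le
  have hg0 : ∀ x, 0 ≤ gE δ w αopt x := fun x => mul_nonneg (hw0 x) (Real.exp_pos _).le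
  have hfp : ∀ s, ∀ᶠ u in 𝓝[>] s, 0 < fE δ c αopt u := by
    intro s
    obtain ⟨cp, cm, wp, wm, h1, h2, h3, h4, p1, p2, p3, p4⟩ := hlim s
    filter_upwards [h1.eventually (lt_mem_nhds p1)] with u hu
    exact mul_pos hu (Real.exp_pos _)
  have hgp : ∀ s, ∀ᶠ u in 𝓝[>] s, 0 < gE δ w αopt u := by
    intro s
    obtain ⟨cp, cm, wp, wm, h1, h2, h3, h4, p1, p2, p3, p4⟩ := hlim s
    filter_upwards [h3.eventually (lt_mem_nhds p3)] with u hu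
    exact mul_pos hu (Real.exp_pos _)
  have hPc : Continuous (fun s => ∫ r in (s - T)..s, fE δ c αopt r) :=
    prim_cont _ hf _ _ (by fun_prop) (by fun_prop)
  have hQc : Continuous (fun s => ∫ r in s..(s + T), gE δ w αopt r) :=
    prim_cont _ hg _ _ (by fun_prop) (by fun_prop)
  have hGlim : ∀ (s x y a : ℝ) (l : Filter ℝ), l ≤ 𝓝 s → Tendsto c l (𝓝 x) → Tendsto w l (𝓝 y) →
      Tendsto αopt l (𝓝 a) → Tendsto (GG T δ c w αopt) l
        (𝓝 (y * Real.exp (-a - δ * s) * (∫ r in (s - T)..s, fE δ c αopt r) -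
          x * Real.exp (a + δ * s) * ∫ r in s..(s + T), gE δ w αopt r)) := by
    intro s x y a l hl hx hy ha
    have hid : Tendsto (fun r : ℝ => δ * r) l (𝓝 (δ * s)) :=
      ((continuous_const.mul continuous_id).tendsto s).mono_left hl
    exact ((hy.mul ((Real.continuous_exp.tendsto _).comp (ha.neg.sub hid))).mul
      ((hPc.tendsto s).mono_left hl)).sub
      ((hx.mul ((Real.continuous_exp.tendsto _).comp (ha.add hid))).mul ((hQc.tendsto s).mono_left hl))
  have hL : ∀ s, ∃ gp gm, Tendsto (GG T δ c w αopt) (𝓝[>] s) (𝓝 gp) ∧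
      Tendsto (GG T δ c w αopt) (𝓝[<] s) (𝓝 gm) := by
    intro s
    obtain ⟨cp, cm, wp, wm, h1, h2, h3, h4, p1, p2, p3, p4⟩ := hlim s
    exact ⟨_, _, hGlim s _ _ _ _ nhdsWithin_le_nhds h1 h3 (hα.tendsto_nhdsGT s),
      hGlim s _ _ _ _ nhdsWithin_le_nhds h2 h4 (hα.tendsto_nhdsLT s)⟩
  obtain ⟨a₁, hap⟩ : ∃ a, Tendsto αopt (𝓝[>] t) (𝓝 a) := ⟨_, hα.tendsto_nhdsGT t⟩
  obtain ⟨a₀, ham⟩ : ∃ a, Tendsto αopt (𝓝[<] t) (𝓝 a) := ⟨_, hα.tendsto_nhdsLT t⟩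
  have hle : a₀ ≤ a₁ := by
    have h1 : a₀ ≤ αopt t := le_of_tendsto ham (by
      filter_upwards [self_mem_nhdsWithin] with u hu using hα (le_of_lt hu))
    have h2 : αopt t ≤ a₁ := ge_of_tendsto hap (by
      filter_upwards [self_mem_nhdsWithin] with u hu using hα (le_of_lt hu))
    exact h1.trans h2
  have hgP := hGlim t _ _ _ _ nhdsWithin_le_nhds hcp hwp hap
  have hgM := hGlim t _ _ _ _ nhdsWithin_le_nhds hcm hwm ham
  obtain ⟨C1, C2, C3⟩ := partC T αopt _ hT hα hI hA hL t _ _ hgP hgM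
  have hPpos := int_pos _ hf hf0 hfp (t - T) t (by linarith)
  have hQpos := int_pos _ hg hg0 hgp t (t + T) (by linarith)
  set P := ∫ r in (t - T)..t, fE δ c αopt r with hPdef
  set Q := ∫ r in t..(t + T), gE δ w αopt r with hQdef
  have eφp : φp = cp / wp := tendsto_nhds_unique hφp (hcp.div hwp pwp.ne')
  have eφm : φm = cm / wm := tendsto_nhds_unique hφm (hcm.div hwm pwm.ne')
  have pφp : 0 < φp := by rw [eφp]; positivity
  have pφm : 0 < φm := by rw [eφm]; positivity
  have ecp : cp = φp * wp := by rw [eφp]; field_simp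
  have ecm : cm = φm * wm := by rw [eφm]; field_simp
  set X := Real.exp (a₁ + δ * t) with hX
  set Y := Real.exp (a₀ + δ * t) with hY
  have hX0 : 0 < X := Real.exp_pos _
  have hY0 : 0 < Y := Real.exp_pos _
  have hYX : Y ≤ X := Real.exp_le_exp.mpr (by linarith)
  have eX : Real.exp (-a₁ - δ * t) = X⁻¹ := by rw [hX, ← Real.exp_neg]; ring_nf
  have eY : Real.exp (-a₀ - δ * t) = Y⁻¹ := by rw [hY, ← Real.exp_neg]; ring_nf
  have fP : wp * Real.exp (-a₁ - δ * t) * P - cp * X * Q = (wp / X) * (P - φp * X ^ 2 * Q) := by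
    rw [eX, ecp]; field_simp
  have fM : wm * Real.exp (-a₀ - δ * t) * P - cm * Y * Q = (wm / Y) * (P - φm * Y ^ 2 * Q) := by
    rw [eY, ecm]; field_simp
  rw [fP] at C1 C2
  rw [fM] at C1 C3
  have kP : 0 < wp / X := by positivity
  have kM : 0 < wm / Y := by positivity
  refine ⟨fun hlt hs => ?_, fun hlt hr hl => ?_⟩
  · obtain ⟨h1, h2⟩ := C1 hs
    have h1 := nonneg_of_mul_nonneg_right h1 kP
    have h2 := nonpos_of_mul_nonpos_right h2 kM
    have h3 : φp * X ^ 2 * Q ≤ φm * Y ^ 2 * Q := by linarith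
    have h4 : φp * X ^ 2 ≤ φm * Y ^ 2 := le_of_mul_le_mul_right h3 hQpos
    have h5 : Y ^ 2 ≤ X ^ 2 := by gcongr
    nlinarith [mul_pos hX0 hX0]
  · have hs := supp_closed αopt hα _ t hr
    obtain ⟨h1, h2⟩ := C1 hs
    have h1 := nonneg_of_mul_nonneg_right h1 kP
    have h2 := nonpos_of_mul_nonpos_right h2 kM
    have h1' := nonpos_of_mul_nonpos_right (C2 hr) kP
    have h2' := nonneg_of_mul_nonneg_right (C3 hl) kM
    have h4 : φp * X ^ 2 = φm * Y ^ 2 := mul_right_cancel₀ hQpos.ne' (by linarith)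
    refine ⟨hs, ?_, ?_⟩
    · intro ap am h5 h6
      have e1 := tendsto_nhds_unique h5 hap
      have e2 := tendsto_nhds_unique h6 ham
      subst e1 e2
      have e3 : φm / φp = Real.exp (2 * (ap - am)) := by
        have : Real.exp (2 * (ap - am)) = (X / Y) ^ 2 := by
          rw [hX, hY, ← Real.exp_sub, ← Real.exp_nat_mul]; push_cast; ring_nf
        rw [this, div_pow, div_eq_div_iff pφp.ne' (by positivity)]
        linarith
      have e4 : Real.log (φm / φp) = 2 * (ap - am) := by rw [e3, Real.log_exp]
      have e5 : 0 < Real.log (φm / φp) := Real.log_pos (by rwa [one_lt_div pφp])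
      constructor <;> linarith
    · intro Sp Sm h5 h6
      have hKc : Continuous (fun s => ∫ r in (0:ℝ)..T, Kker T δ ηb s r * fE δ c αopt r) := by
        unfold Kker
        simp only [K_int _ _ _ _ _ hT hf]
        exact (continuous_const.mul (prim_cont _ hf _ _ (by fun_prop) (by fun_prop))).add
          (continuous_const.mul (prim_cont _ hf _ _ (by fun_prop) (by fun_prop)))
      have hSe : Sfun T δ ηb c αopt = fun s => Real.exp (-(αopt s) - δ * s) *
          ∫ r in (0:ℝ)..T, Kker T δ ηb s r * fE δ c αopt r := by
        ext s; unfold Sfun fE; simp only [mul_assoc]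
      have hKpos : 0 < ∫ r in (0:ℝ)..T, Kker T δ ηb t r * fE δ c αopt r := by
        obtain ⟨k1, k2⟩ := k_rel T (ηb + δ) hT hlam
        have k3 : 0 < (Real.exp ((ηb + δ) * T) - 1)⁻¹ := by
          rw [k2]; exact mul_pos k1 (Real.exp_pos _)
        have i0 := int_pos _ hf hf0 hfp 0 T hT
        unfold Kker
        rw [K_int _ _ _ _ _ hT hf]
        set τ := max 0 (min t T) with hτ
        have t0 : 0 ≤ τ := le_max_left _ _
        have t1 : τ ≤ T := max_le hT.le (min_le_right _ _)
        have i1 : 0 ≤ ∫ r in (0:ℝ)..τ, fE δ c αopt r :=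
          intervalIntegral.integral_nonneg t0 (fun x _ => hf0 x)
        have i2 : 0 ≤ ∫ r in τ..T, fE δ c αopt r :=
          intervalIntegral.integral_nonneg t1 (fun x _ => hf0 x)
        rw [← intervalIntegral.integral_add_adjacent_intervals (hf 0 τ) (hf τ T)] at i0
        rcases i1.lt_or_eq with i | i
        · exact add_pos_of_pos_of_nonneg (mul_pos k1 i) (mul_nonneg k3.le i2)
        · exact add_pos_of_nonneg_of_pos (mul_nonneg k1.le i1) (mul_pos k3 (by linarith))
      have hSl : ∀ (a : ℝ) (l : Filter ℝ), l ≤ 𝓝 t → Tendsto αopt l (𝓝 a) →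
          Tendsto (Sfun T δ ηb c αopt) l (𝓝 (Real.exp (-a - δ * t) *
            ∫ r in (0:ℝ)..T, Kker T δ ηb t r * fE δ c αopt r)) := by
        intro a l hl ha
        have hid : Tendsto (fun r : ℝ => δ * r) l (𝓝 (δ * t)) :=
          ((continuous_const.mul continuous_id).tendsto t).mono_left hl
        rw [hSe]
        exact ((Real.continuous_exp.tendsto _).comp (ha.neg.sub hid)).mul
          ((hKc.tendsto t).mono_left hl)
      have e1 := tendsto_nhds_unique h5 (hSl _ _ nhdsWithin_le_nhds hap)
      have e2 := tendsto_nhds_unique h6 (hSl _ _ nhdsWithin_le_nhds ham)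
      set Z := ∫ r in (0:ℝ)..T, Kker T δ ηb t r * fE δ c αopt r with hZ
      have e3 : Sp / Sm = Y / X := by
        rw [e1, e2, eX, eY]; field_simp
      have e4 : Y / X = Real.sqrt (φp / φm) := by
        symm
        rw [Real.sqrt_eq_iff_mul_self_eq (by positivity) (by positivity)]
        rw [div_mul_div_comm, div_eq_div_iff (by positivity) (by positivity)]
        linarith
      refine ⟨e3.trans e4, ?_⟩
      rw [e3, e4, Real.sqrt_lt' one_pos, one_pow, div_lt_one pφm]
      exact hlt
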